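/- Every 10-element clique in C with weights in {1,3} is contained in a 16-element clique with weights in {1,3} of the form {c_1, d_1, ..., c_8, d_8}, where B(c_i, c_j) = 1 for all i \neq j and B(c_i, d_i) = 3 for each i; moreover, every clique in C with weights in {1,3} has at most 16 elements. -/

import Mathlib

/-- The intersection pairing on `ℤ⁹`, the Picard lattice of a del Pezzo surface of degree 1. -/
def B (v w : Fin 9 → ℤ) : ℤ := v 0 * w 0 - ∑ i : Fin 8, v i.succ * w i.succ

/-- The canonical class `K = (-3, -1, …, -1)`. -/
def Kcl : Fin 9 → ℤ := fun i => if i = 0 then -3 else -1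

/-- A vector is an exceptional class if `B(v,v) = -1` and `B(v,K) = -1`. -/
def IsExc (v : Fin 9 → ℤ) : Prop := B v v = -1 ∧ B v Kcl = -1

/-- The type of exceptional classes (the set `C`). -/
abbrev Exc : Type := {v : Fin 9 → ℤ // IsExc v}

/-- The pairing on exceptional classes. -/
def Bx (x y : Exc) : ℤ := B x.1 y.1

/-- `S` is a clique with weights in `M` if `B(x,y) ∈ M` for all distinct `x, y ∈ S`. -/
def IsClique (M : Set ℤ) (S : Finset Exc) : Prop :=
  ∀ x ∈ S, ∀ y ∈ S, x ≠ y → Bx x y ∈ M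

/-- A bijection of `C` preserving the pairing `B`: an element of the Weyl group `W`. -/
def PreservesB (g : Exc ≃ Exc) : Prop := ∀ x y : Exc, Bx (g x) (g y) = Bx x y

/-- Two finite subsets of `C` lie in the same orbit of `W`. -/
def SameOrbit (S T : Finset Exc) : Prop :=
  ∃ g : Exc ≃ Exc, PreservesB g ∧ S.image g = T

lemma B_eq (v w : Fin 9 → ℤ) : B v w = v 0 * w 0 - (v 1 * w 1 + v 2 * w 2 + v 3 * w 3 + v 4 * w 4
    + v 5 * w 5 + v 6 * w 6 + v 7 * w 7 + v 8 * w 8) := by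
  unfold B
  rw [Fin.sum_univ_eight]
  rfl

lemma B_sub (x y z : Fin 9 → ℤ) : B (x - y) z = B x z - B y z := by
  simp only [B_eq, Pi.sub_apply]; ring

lemma B_add (x y z : Fin 9 → ℤ) : B (x + y) z = B x z + B y z := by
  simp only [B_eq, Pi.add_apply]; ring

lemma B_smul (n : ℤ) (x z : Fin 9 → ℤ) : B (n • x) z = n * B x z := by
  simp only [B_eq, Pi.smul_apply, smul_eq_mul]; ring

lemma B_comm (x y : Fin 9 → ℤ) : B x y = B y x := by
  simp only [B_eq]; ring

lemma B_KK : B Kcl Kcl = 1 := by decide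

lemma B_K (v : Fin 9 → ℤ) : B v Kcl = -3 * v 0 + (v 1 + v 2 + v 3 + v 4 + v 5 + v 6 + v 7 + v 8) := by
  simp [B_eq, Kcl]; ring

lemma B_neg (r : Fin 9 → ℤ) (h : B r Kcl = 0) : 
    r 1 ^ 2 + r 2 ^ 2 + r 3 ^ 2 + r 4 ^ 2 + r 5 ^ 2 + r 6 ^ 2 + r 7 ^ 2 + r 8 ^ 2 ≤ -9 * B r r := by
  have h1 : B r Kcl = -3 * r 0 + ∑ i : Fin 8, r i.succ := by
    rw [B_K, Fin.sum_univ_eight]; rfl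
  have h2 := sq_sum_le_card_mul_sum_sq (s := Finset.univ) (f := fun i : Fin 8 => r i.succ)
  have h3 : ∑ i : Fin 8, r i.succ = 3 * r 0 := by linarith
  have h4 : ∑ i : Fin 8, r i.succ ^ 2 = r 1 ^ 2 + r 2 ^ 2 + r 3 ^ 2 + r 4 ^ 2 + r 5 ^ 2 + r 6 ^ 2 + r 7 ^ 2 + r 8 ^ 2 := by
    rw [Fin.sum_univ_eight]; rfl
  rw [h3, h4] at h2
  simp only [Finset.card_univ, Fintype.card_fin] at h2
  rw [B_eq]
  push_cast at h2
  nlinarith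

lemma B_nonpos (r : Fin 9 → ℤ) (h : B r Kcl = 0) : B r r ≤ 0 := by
  have := B_neg r h
  have : 0 ≤ r 1 ^ 2 + r 2 ^ 2 + r 3 ^ 2 + r 4 ^ 2 + r 5 ^ 2 + r 6 ^ 2 + r 7 ^ 2 + r 8 ^ 2 := by
    positivity
  linarith

lemma B_zero (r : Fin 9 → ℤ) (h : B r Kcl = 0) (h0 : B r r = 0) : r = 0 := by
  have h1 := B_neg r h
  rw [h0] at h1
  have z : ∀ t : ℤ, t ^ 2 ≤ 0 → t = 0 := fun t ht => by
    have := sq_nonneg t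
    exact pow_eq_zero_iff (two_ne_zero) |>.1 (le_antisymm ht this)
  have e1 : r 1 = 0 := z _ (by nlinarith [sq_nonneg (r 1), sq_nonneg (r 2), sq_nonneg (r 3), sq_nonneg (r 4), sq_nonneg (r 5), sq_nonneg (r 6), sq_nonneg (r 7), sq_nonneg (r 8)])
  have e2 : r 2 = 0 := z _ (by nlinarith [sq_nonneg (r 1), sq_nonneg (r 2), sq_nonneg (r 3), sq_nonneg (r 4), sq_nonneg (r 5), sq_nonneg (r 6), sq_nonneg (r 7), sq_nonneg (r 8)])
  have e3 : r 3 = 0 := z _ (by nlinarith [sq_nonneg (r 1), sq_nonneg (r 2), sq_nonneg (r 3), sq_nonneg (r 4), sq_nonneg (r 5), sq_nonneg (r 6), sq_nonneg (r 7), sq_nonneg (r 8)])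
  have e4 : r 4 = 0 := z _ (by nlinarith [sq_nonneg (r 1), sq_nonneg (r 2), sq_nonneg (r 3), sq_nonneg (r 4), sq_nonneg (r 5), sq_nonneg (r 6), sq_nonneg (r 7), sq_nonneg (r 8)])
  have e5 : r 5 = 0 := z _ (by nlinarith [sq_nonneg (r 1), sq_nonneg (r 2), sq_nonneg (r 3), sq_nonneg (r 4), sq_nonneg (r 5), sq_nonneg (r 6), sq_nonneg (r 7), sq_nonneg (r 8)])
  have e6 : r 6 = 0 := z _ (by nlinarith [sq_nonneg (r 1), sq_nonneg (r 2), sq_nonneg (r 3), sq_nonneg (r 4), sq_nonneg (r 5), sq_nonneg (r 6), sq_nonneg (r 7), sq_nonneg (r 8)])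
  have e7 : r 7 = 0 := z _ (by nlinarith [sq_nonneg (r 1), sq_nonneg (r 2), sq_nonneg (r 3), sq_nonneg (r 4), sq_nonneg (r 5), sq_nonneg (r 6), sq_nonneg (r 7), sq_nonneg (r 8)])
  have e8 : r 8 = 0 := z _ (by nlinarith [sq_nonneg (r 1), sq_nonneg (r 2), sq_nonneg (r 3), sq_nonneg (r 4), sq_nonneg (r 5), sq_nonneg (r 6), sq_nonneg (r 7), sq_nonneg (r 8)])
  rw [B_K, e1, e2, e3, e4, e5, e6, e7, e8] at h
  have e0 : r 0 = 0 := by omega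
  funext i
  fin_cases i <;> assumption

lemma B_diff (x y : Exc) : B (x.1 - y.1) (x.1 - y.1) = -2 - 2 * Bx x y ∧ B (x.1 - y.1) Kcl = 0 := by
  have hx := x.2
  have hy := y.2
  unfold IsExc at hx hy
  constructor
  · rw [B_sub, B_comm x.1, B_comm y.1, B_sub, B_sub, B_comm y.1 x.1]
    unfold Bx
    linarith [hx.1, hy.1]
  · rw [B_sub, hx.2, hy.2]; rfl

lemma B_summ (x y : Exc) : B (x.1 + y.1 + (2 : ℤ) • Kcl) (x.1 + y.1 + (2 : ℤ) • Kcl) = 2 * Bx x y - 6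
    ∧ B (x.1 + y.1 + (2 : ℤ) • Kcl) Kcl = 0 := by
  have hx := x.2
  have hy := y.2
  unfold IsExc at hx hy
  have key : B (x.1 + y.1 + (2 : ℤ) • Kcl) Kcl = 0 := by
    rw [B_add, B_add, B_smul, hx.2, hy.2, B_KK]; rfl
  refine ⟨?_, key⟩
  rw [B_add, B_smul, B_comm Kcl, key, B_comm _ (x.1 + y.1 + _), B_add, B_add, B_smul, 
    B_comm x.1 (x.1 + y.1), B_comm y.1 (x.1 + y.1), B_comm Kcl, B_add, B_add, B_add, B_comm y.1 x.1,
    hx.1, hy.1, hx.2, hy.2]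
  unfold Bx
  ring

lemma Bx_ge (x y : Exc) : -1 ≤ Bx x y := by
  have := B_diff x y
  have := B_nonpos _ this.2
  omega

lemma Bx_le (x y : Exc) : Bx x y ≤ 3 := by
  have := B_summ x y
  have := B_nonpos _ this.2
  omega

lemma Bx_eq (x y : Exc) (h : Bx x y = -1) : x = y := by
  have h1 := B_diff x y
  have := B_zero _ h1.2 (by rw [h1.1, h]; rfl)
  exact Subtype.ext (sub_eq_zero.1 this)

lemma Bx_self (x : Exc) : Bx x x = -1 := x.2.1

/-- the opposite class -/
def opp (x : Exc) : Exc := ⟨-(2 : ℤ) • Kcl - x.1, by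
  have hx := x.2
  unfold IsExc at hx ⊢
  have key : B (-(2 : ℤ) • Kcl - x.1) Kcl = -1 := by
    rw [B_sub, B_smul, hx.2, B_KK]; rfl
  refine ⟨?_, key⟩
  rw [B_sub, B_smul, B_comm Kcl, key, B_comm x.1, B_sub, B_smul, B_comm Kcl, hx.1, hx.2]; rfl⟩

lemma Bx_opp (x : Exc) : Bx x (opp x) = 3 := by
  have hx := x.2
  unfold IsExc at hx
  unfold Bx opp
  rw [B_comm, B_sub, B_smul, B_comm Kcl, hx.1, hx.2]; rfl

lemma Bx_three (x y : Exc) (h : Bx x y = 3) : y = opp x := by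
  have h1 := B_summ x y
  have := B_zero _ h1.2 (by rw [h1.1, h]; rfl)
  apply Subtype.ext
  unfold opp
  show y.1 = -(2 : ℤ) • Kcl - x.1
  rw [neg_smul]
  have h2 : y.1 = (x.1 + y.1 + (2 : ℤ) • Kcl) + (-((2 : ℤ) • Kcl) - x.1) := by abel
  rw [h2, this, zero_add]

/-- reduction mod 2 of the root `x + K` -/
def ph (x : Exc) : Fin 9 → ZMod 2 := fun i => ((x.1 i + Kcl i : ℤ) : ZMod 2)

lemma ph_opp (x : Exc) : ph (opp x) = ph x := by
  funext i
  unfold ph opp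
  rw [ZMod.intCast_eq_intCast_iff_dvd_sub]
  simp only [Pi.sub_apply, Pi.smul_apply, smul_eq_mul]
  exact ⟨x.1 i + Kcl i, by push_cast; ring⟩

lemma ph_inj (x y : Exc) (h : ph x = ph y) : y = x ∨ y = opp x := by
  have h1 : ∀ i, ∃ z : ℤ, (x.1 - y.1) i = 2 * z := by
    intro i
    have := congrFun h i
    unfold ph at this
    rw [ZMod.intCast_eq_intCast_iff_dvd_sub] at this
    obtain ⟨z, hz⟩ := this
    refine ⟨-z, ?_⟩
    simp only [Pi.sub_apply]
    push_cast at hz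
    linarith
  choose z hz using h1
  have hz' : x.1 - y.1 = (2 : ℤ) • z := by
    funext i
    rw [hz]; rfl
  have h2 := B_diff x y
  rw [hz', B_smul, B_smul, B_comm z, B_smul] at h2
  have h3 : Even (B z z) := by
    have h4 : B z Kcl = 0 := by omega
    have h5 : Even (B z z - B z Kcl) := by
      rw [B_K, B_eq]
      have e : ∀ t : ℤ, (t * t) % 2 = t % 2 := by
        intro t
        rcases Int.emod_two_eq t with h | h <;> simp [Int.mul_emod, h]
      have e0 := e (z 0)
      have e1 := e (z 1)
      have e2 := e (z 2)
      have e3 := e (z 3)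
      have e4 := e (z 4)
      have e5 := e (z 5)
      have e6 := e (z 6)
      have e7 := e (z 7)
      have e8 := e (z 8)
      rw [Int.even_iff]
      omega
    rwa [h4, sub_zero] at h5
  obtain ⟨k, hk⟩ := h3
  have h5 := Bx_ge x y
  have h6 := Bx_le x y
  have h7 : Bx x y = -1 ∨ Bx x y = 3 := by omega
  rcases h7 with h7 | h7
  · exact Or.inl (Bx_eq x y h7).symm
  · exact Or.inr (Bx_three x y h7)

lemma ph_dot (x y : Exc) : ph x ⬝ᵥ ph y = ((Bx x y - 1 : ℤ) : ZMod 2) := by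
  have h : B (x.1 + Kcl) (y.1 + Kcl) = Bx x y - 1 := by
    have hx := x.2
    have hy := y.2
    unfold IsExc at hx hy
    rw [B_add, B_comm x.1, B_comm Kcl, B_add, B_add, B_comm Kcl x.1, B_comm y.1 x.1, hx.2, hy.2, B_KK]
    unfold Bx
    ring
  rw [← h, B_eq]
  have e : ∀ a b : ZMod 2, a - b = a + b := by decide
  simp only [dotProduct, Fin.sum_univ_succ, ph]
  push_cast
  rw [e]
  simp only [Pi.add_apply]
  push_cast
  simp [Fin.succ]
  ring

def sq4 (t : ZMod 2) : ZMod 4 := if t = 0 then 0 else 1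
def hf (t : ZMod 2) : ZMod 4 := if t = 0 then 0 else 2

lemma sq4_add : ∀ a b : ZMod 2, sq4 (a + b) = sq4 a + sq4 b + hf (a * b) := by decide
lemma hf_add : ∀ a b : ZMod 2, hf (a + b) = hf a + hf b := by decide
lemma hf_neg : ∀ a : ZMod 2, -hf a = hf a := by decide

lemma sq4_int (n : ℤ) : sq4 (n : ZMod 2) = ((n * n : ℤ) : ZMod 4) := by
  have h : ∀ t : ZMod 4, sq4 (ZMod.castHom (show 2 ∣ 4 by norm_num) (ZMod 2) t) = t * t := by decide
  have := h (n : ZMod 4)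
  rw [map_intCast] at this
  rw [this]; push_cast; rfl

/-- The quadratic form (norm mod 4). -/
def q (w : Fin 9 → ZMod 2) : ZMod 4 :=
  sq4 (w 0) - (sq4 (w 1) + sq4 (w 2) + sq4 (w 3) + sq4 (w 4) + sq4 (w 5) + sq4 (w 6) + sq4 (w 7)
    + sq4 (w 8))

lemma q_add (v w : Fin 9 → ZMod 2) (h : v ⬝ᵥ w = 0) : q (v + w) = q v + q w := by
  have h0 : hf (v 0 * w 0 + (v 1 * w 1 + v 2 * w 2 + v 3 * w 3 + v 4 * w 4
    + v 5 * w 5 + v 6 * w 6 + v 7 * w 7 + v 8 * w 8)) = 0 := by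
    have : v ⬝ᵥ w = v 0 * w 0 + (v 1 * w 1 + v 2 * w 2 + v 3 * w 3 + v 4 * w 4
      + v 5 * w 5 + v 6 * w 6 + v 7 * w 7 + v 8 * w 8) := by
      simp [dotProduct, Fin.sum_univ_succ, Fin.succ]; ring
    rw [← this, h]; rfl
  rw [hf_add, ← hf_neg (_ + _)] at h0
  simp only [hf_add] at h0
  simp only [q, Pi.add_apply, sq4_add]
  linear_combination h0

lemma q_ph (x : Exc) : q (ph x) = 2 := by
  have h : B (x.1 + Kcl) (x.1 + Kcl) = -2 := by
    have hx := x.2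
    unfold IsExc at hx
    rw [B_add, B_comm x.1, B_comm Kcl, B_add, B_add, B_comm Kcl x.1, hx.1, hx.2, B_KK]
    rfl
  rw [B_eq] at h
  have h' := congrArg (fun t : ℤ => (t : ZMod 4)) h
  simp only [q, ph, sq4_int]
  simp only [Pi.add_apply] at h'
  push_cast at h' ⊢
  rw [h']; rfl

lemma q_self (w : Fin 9 → ZMod 2) (h : w ⬝ᵥ w = 0) : q w = 0 ∨ q w = 2 := by
  have h1 := q_add w w h
  have h2 : w + w = 0 := CharTwo.add_self_eq_zero w
  have h3 : q 0 = 0 := by decide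
  rw [h2, h3] at h1
  have : ∀ t : ZMod 4, 0 = t + t → t = 0 ∨ t = 2 := by decide
  exact this _ h1

/-- number of ones among the last eight bits -/
def wt (w : Fin 9 → ZMod 2) : ℕ :=
  (w 1).val + (w 2).val + (w 3).val + (w 4).val + (w 5).val + (w 6).val + (w 7).val + (w 8).val

/-- explicit root lifting -/
def rep (w : Fin 9 → ZMod 2) : Fin 9 → ℤ := fun i =>
  if wt w = 2 then
    (if w i = 0 then 0 else if ∃ j, j < i ∧ w j ≠ 0 then -1 else 1)
  else if wt w = 6 then (if i = 0 then 2 else if w i = 0 then 0 else 1)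
  else if wt w = 3 then (if w i = 0 then 0 else 1)
  else (if i = 0 then 3 else if w i = 0 then 2 else 1)

lemma rep_spec : ∀ a b c d e f g h k : ZMod 2,
    (let w : Fin 9 → ZMod 2 := ![a, b, c, d, e, f, g, h, k]
     a + b + c + d + e + f + g + h + k = 0 → q w = 2 →
      B (fun i => rep w i - Kcl i) (fun i => rep w i - Kcl i) = -1 ∧
      B (fun i => rep w i - Kcl i) Kcl = -1 ∧
      ∀ i, ((rep w i : ℤ) : ZMod 2) = w i) := by
  decide +kernel

lemma ph_surj (w : Fin 9 → ZMod 2) (h : w ⬝ᵥ w = 0) (h2 : q w = 2) : ∃ x, ph x = w := by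
  have h1 := rep_spec (w 0) (w 1) (w 2) (w 3) (w 4) (w 5) (w 6) (w 7) (w 8)
  have hw : ![w 0, w 1, w 2, w 3, w 4, w 5, w 6, w 7, w 8] = w := by
    funext i; fin_cases i <;> rfl
  simp only [hw] at h1
  have hs : w 0 + w 1 + w 2 + w 3 + w 4 + w 5 + w 6 + w 7 + w 8 = 0 := by
    have e : ∀ t : ZMod 2, t * t = t := by decide
    rw [← h]
    simp [dotProduct, Fin.sum_univ_succ, Fin.succ, e]; ring
  obtain ⟨h3, h4, h5⟩ := h1 hs h2
  refine ⟨⟨fun i => rep w i - Kcl i, h3, h4⟩, ?_⟩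
  funext i
  simp only [ph, sub_add_cancel]
  exact h5 i

lemma clique_structure (S : Finset Exc) (hS : IsClique {1, 3} S) :
    ∃ A : Finset (Fin 9 → ZMod 2), (∀ x ∈ S, ph x ∈ A) ∧ A.card ≤ 8 ∧ (5 ≤ A.card → A.card = 8) ∧
      (∀ v ∈ A, ∀ w ∈ A, v ⬝ᵥ w = 0) ∧ (∀ v ∈ A, q v = 2) := by
  classical
  let W : Submodule (ZMod 2) (Fin 9 → ZMod 2) := Submodule.span (ZMod 2) (ph '' (S : Set Exc))
  have hW : ∀ v ∈ W, ∀ w ∈ W, v ⬝ᵥ w = 0 := by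
    intro v hv w hw
    induction hv, hw using Submodule.span_induction₂ with
    | mem_mem x y hx hy =>
      obtain ⟨a, ha, rfl⟩ := hx
      obtain ⟨b, hb, rfl⟩ := hy
      rw [ph_dot]
      by_cases hab : a = b
      · subst hab; rw [Bx_self]; rfl
      · rcases hS a ha b hb hab with h | h
        · rw [h]; rfl
        · rw [Set.mem_singleton_iff.1 h]; rfl
    | zero_left => simp
    | zero_right => simp
    | add_left x y z _ _ _ h1 h2 => rw [add_dotProduct, h1, h2, add_zero]
    | add_right x y z _ _ _ h1 h2 => rw [dotProduct_add, h1, h2, add_zero]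
    | smul_left r x y _ _ h => rw [smul_dotProduct, h, smul_zero]
    | smul_right r x y _ _ h => rw [dotProduct_smul, h, smul_zero]
  let F : LinearMap.BilinForm (ZMod 2) (Fin 9 → ZMod 2) := Matrix.toBilin' 1
  have hF : F.Nondegenerate := by
    apply Matrix.nondegenerate_toBilin'_iff.2
    exact Matrix.nondegenerate_of_det_ne_zero (by simp)
  have hle : W ≤ F.orthogonal W := by
    intro v hv w hw
    show F w v = 0
    have : F w v = w ⬝ᵥ v := by simp [F, Matrix.toBilin'_apply']
    rw [this]; exact hW w hw v hv
  have hdim : Module.finrank (ZMod 2) W ≤ 4 := by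
    have h1 := Submodule.finrank_mono hle
    rw [LinearMap.BilinForm.finrank_orthogonal hF] at h1
    simp at h1
    omega
  have hcard : Nat.card W = 2 ^ Module.finrank (ZMod 2) W := by
    rw [Module.natCard_eq_pow_finrank (K := ZMod 2), Nat.card_zmod]
  let WF : Finset (Fin 9 → ZMod 2) := Finset.univ.filter (· ∈ W)
  have hWF : WF.card = 2 ^ Module.finrank (ZMod 2) W := by
    rw [← hcard, Nat.card_eq_fintype_card, Fintype.card_subtype]
  let A := WF.filter (fun w => q w = 2)
  have hAW : ∀ v ∈ A, v ∈ W := fun v hv => by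
    simp only [A, WF, Finset.mem_filter, Finset.mem_univ, true_and] at hv
    exact hv.1
  have hAq : ∀ v ∈ A, q v = 2 := fun v hv => (Finset.mem_filter.1 hv).2
  have hAm : ∀ v, v ∈ W → q v = 2 → v ∈ A := fun v h1 h2 => by
    simp only [A, WF, Finset.mem_filter, Finset.mem_univ, true_and]
    exact ⟨h1, h2⟩
  have hhalf : A.Nonempty → 2 * A.card = WF.card := by
    rintro ⟨u, hu⟩
    have h1 := Finset.card_filter_add_card_filter_not (s := WF) (fun w => q w = 2)
    have h2 : A.card = (WF.filter (fun w => ¬ q w = 2)).card := by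
      apply Finset.card_bij' (fun v _ => u + v) (fun v _ => u + v)
      · intro v hv
        simp only [WF, Finset.mem_filter, Finset.mem_univ, true_and]
        refine ⟨W.add_mem (hAW _ hu) (hAW _ hv), ?_⟩
        rw [q_add _ _ (hW _ (hAW _ hu) _ (hAW _ hv)), hAq _ hu, hAq _ hv]
        decide
      · intro v hv
        simp only [WF, Finset.mem_filter, Finset.mem_univ, true_and] at hv
        refine hAm _ (W.add_mem (hAW _ hu) hv.1) ?_
        rw [q_add _ _ (hW _ (hAW _ hu) _ hv.1), hAq _ hu]
        rcases q_self v (hW _ hv.1 _ hv.1) with h | h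
        · rw [h]; rfl
        · exact absurd h hv.2
      · intro v _
        rw [← add_assoc, CharTwo.add_self_eq_zero, zero_add]
      · intro v _
        rw [← add_assoc, CharTwo.add_self_eq_zero, zero_add]
    change A.card + _ = _ at h1
    omega
  have hc : WF.card ≤ 16 := by
    rw [hWF]
    exact Nat.pow_le_pow_right (by norm_num) hdim
  refine ⟨A, ?_, ?_, ?_, ?_, hAq⟩
  · intro x hx
    exact hAm _ (Submodule.subset_span ⟨x, hx, rfl⟩) (q_ph x)
  · rcases A.eq_empty_or_nonempty with h | h
    · rw [h]; simp
    · have := hhalf h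
      omega
  · intro h5
    have h1 := hhalf (Finset.card_pos.1 (by omega))
    rw [hWF] at h1
    interval_cases hd : Module.finrank (ZMod 2) W <;> omega
  · intro v hv w hw
    exact hW v (hAW v hv) w (hAW w hw)

lemma card_le_two (S : Finset Exc) (A : Finset (Fin 9 → ZMod 2)) (h : ∀ x ∈ S, ph x ∈ A) :
    S.card ≤ 2 * A.card := by
  classical
  apply Finset.card_le_mul_card_image_of_maps_to h
  intro b _
  rcases (S.filter (fun x => ph x = b)).eq_empty_or_nonempty with h0 | ⟨x, hx⟩
  · rw [h0]; simp
  · have hx' := (Finset.mem_filter.1 hx).2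
    calc _ ≤ ({x, opp x} : Finset Exc).card := by
          apply Finset.card_le_card
          intro y hy
          have hy' := (Finset.mem_filter.1 hy).2
          rcases ph_inj x y (by rw [hx', hy']) with h | h <;> simp [h]
      _ ≤ 2 := Finset.card_le_two

lemma dot_odd (x y : Exc) (hxy : x ≠ y) (h : ph x ⬝ᵥ ph y = 0) : Bx x y = 1 ∨ Bx x y = 3 := by
  rw [ph_dot, ZMod.intCast_zmod_eq_zero_iff_dvd] at h
  have h1 := Bx_ge x y
  have h2 := Bx_le x y
  have h3 : Bx x y ≠ -1 := fun h => hxy (Bx_eq x y h)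
  push_cast at h
  omega

/-- Every 10-element clique in `C` with weights in `{1,3}` is contained in a 16-element clique
with weights in `{1,3}` of the form `{c₁, d₁, …, c₈, d₈}` with `B(cᵢ,cⱼ) = 1` for `i ≠ j` and
`B(cᵢ,dᵢ) = 3` for each `i`; moreover every clique with weights in `{1,3}` has at most 16
elements. -/
theorem stmt8 :
    (∀ S : Finset Exc, S.card = 10 → IsClique {1, 3} S →
      ∃ T : Finset Exc, S ⊆ T ∧ T.card = 16 ∧ IsClique {1, 3} T ∧
        ∃ c d : Fin 8 → Exc,
          T = Finset.image c Finset.univ ∪ Finset.image d Finset.univ ∧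
          (∀ i j : Fin 8, i ≠ j → Bx (c i) (c j) = 1) ∧
          (∀ i : Fin 8, Bx (c i) (d i) = 3)) ∧
    (∀ S : Finset Exc, IsClique {1, 3} S → S.card ≤ 16) := by
  classical
  constructor
  · intro S hS hcl
    obtain ⟨A, hA, hA8, hA5, hdot, hq⟩ := clique_structure S hcl
    have h10 := card_le_two S A hA
    have h8 : A.card = 8 := hA5 (by omega)
    let e : Fin 8 ≃ A := (A.equivFinOfCardEq h8).symm
    have hex : ∀ i : Fin 8, ∃ x, ph x = (e i).1 := fun i =>
      ph_surj _ (hdot _ (e i).2 _ (e i).2) (hq _ (e i).2)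
    choose c hc using hex
    have hcA : ∀ i, ph (c i) ∈ A := fun i => by rw [hc]; exact (e i).2
    have hinj : ∀ i j, ph (c i) = ph (c j) → i = j := by
      intro i j h
      rw [hc, hc] at h
      exact e.injective (Subtype.ext h)
    have hci : Function.Injective c := fun i j h => hinj i j (by rw [h])
    have hdi : Function.Injective (fun i => opp (c i)) := fun i j h => by
      apply hinj i j
      rw [← ph_opp (c i), ← ph_opp (c j)]
      exact congrArg ph h
    let T := Finset.image c Finset.univ ∪ Finset.image (fun i => opp (c i)) Finset.univ
    have hTA : ∀ x ∈ T, ph x ∈ A := by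
      intro x hx
      simp only [T, Finset.mem_union, Finset.mem_image, Finset.mem_univ, true_and] at hx
      rcases hx with ⟨i, rfl⟩ | ⟨i, rfl⟩
      · exact hcA i
      · rw [ph_opp]; exact hcA i
    refine ⟨T, ?_, ?_, ?_, c, fun i => opp (c i), rfl, ?_, fun i => Bx_opp _⟩
    · intro x hx
      obtain ⟨i, hi⟩ := e.surjective ⟨ph x, hA x hx⟩
      have h1 : ph (c i) = ph x := by rw [hc, hi]
      simp only [T, Finset.mem_union, Finset.mem_image, Finset.mem_univ, true_and]
      rcases ph_inj _ _ h1 with h | h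
      · exact Or.inl ⟨i, h.symm⟩
      · exact Or.inr ⟨i, h.symm⟩
    · rw [Finset.card_union_of_disjoint, Finset.card_image_of_injective _ hci,
        Finset.card_image_of_injective _ hdi]
      · simp
      · rw [Finset.disjoint_left]
        intro x hx hx'
        simp only [Finset.mem_image, Finset.mem_univ, true_and] at hx hx'
        obtain ⟨i, rfl⟩ := hx
        obtain ⟨j, hj⟩ := hx'
        have hij : j = i := by
          apply hinj
          rw [← ph_opp (c j), hj]
        subst hij
        have h3 := Bx_opp (c j)
        rw [hj, Bx_self] at h3
        omega
    · intro x hx y hy hxy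
      exact dot_odd x y hxy (hdot _ (hTA x hx) _ (hTA y hy))
    · intro i j hij
      rcases dot_odd (c i) (c j) (fun h => hij (hci h)) (hdot _ (hcA i) _ (hcA j)) with h | h
      · exact h
      · exfalso
        apply hij
        apply hinj
        rw [Bx_three _ _ h, ph_opp]
  · intro S hcl
    obtain ⟨A, hA, hA8, -⟩ := clique_structure S hcl
    have := card_le_two S A hA
    omega
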